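/- Assume (A), (A+), ℓ ∈ C¹(X) and ℓ Lipschitz on bounded subsets of X. Fix ū, u ∈ 𝒰 and x₀ ∈ X, let x_t := x^u_t, p̄_t := ℓ ∘ Φ̄_{t,T}, and g(t) := p̄_t(x_t). Then g is absolutely continuous on I and, for almost every t ∈ I, g'(t) = (u(t) − ū(t))ᵀ G_t(x_t)' Dp̄_t(x_t), where G_t(x)' Dp̄_t(x) denotes the vector w ∈ ℝ^m determined by vᵀ w = Dp̄_t(x)[G_t(x) v] for all v ∈ ℝ^m. -/

import Mathlib

open MeasureTheory Set Filter
open scoped RealInnerProductSpace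

noncomputable section

/-- `φ` is a mild solution on `[s,T]` with initial data `(s, x)` for the semigroup `S`. -/
def IsMildSol {X : Type*} [NormedAddCommGroup X] [NormedSpace ℝ X]
    (T : ℝ) (S : ℝ → X →L[ℝ] X) (F : ℝ → X → X) (s : ℝ) (x : X) (φ : ℝ → X) : Prop :=
  ContinuousOn φ (Set.Icc s T) ∧
    ∀ t ∈ Set.Icc s T, φ t = S (t - s) x + ∫ τ in s..t, S (t - τ) (F τ (φ τ))

theorem aux_carath {X Y : Type*} [NormedAddCommGroup X] [NormedAddCommGroup Y]
    {μ : Measure ℝ} (H : ℝ → X → Y) (hm : ∀ x, AEStronglyMeasurable (fun t => H t x) μ)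
    (hc : ∀ᵐ t ∂μ, Continuous (H t)) (φ : ℝ → X) (hφ : AEStronglyMeasurable φ μ) :
    AEStronglyMeasurable (fun t => H t (φ t)) μ := by
  obtain ⟨ψ, hψ, he⟩ := hφ
  have h1 : AEStronglyMeasurable (fun t => H t (ψ t)) μ := by
    refine aestronglyMeasurable_of_tendsto_ae atTop (f := fun n t => H t (hψ.approx n t)) ?_ ?_
    · intro n
      have : (fun t => H t (hψ.approx n t)) = fun t => ∑ y ∈ (hψ.approx n).range,
          ((hψ.approx n) ⁻¹' {y}).indicator (fun t => H t y) t := by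
        funext t
        rw [Finset.sum_eq_single (hψ.approx n t)]
        · simp
        · intro b _ hb
          rw [Set.indicator_of_notMem]
          simpa using hb.symm
        · intro h
          exact absurd ((hψ.approx n).mem_range_self t) h
      rw [this]
      refine Finset.aestronglyMeasurable_fun_sum _ fun y _ => ?_
      exact (hm y).indicator ((hψ.approx n).measurableSet_fiber y)
    · filter_upwards [hc] with t ht
      exact (ht.tendsto _).comp (hψ.tendsto_approx t)
  refine h1.congr ?_
  filter_upwards [he] with t ht
  rw [ht]

theorem aux_gronwall {X : Type*} [NormedAddCommGroup X] [NormedSpace ℝ X]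
    {s r A L B : ℝ} (hsr : s ≤ r) (hA : 0 ≤ A) (hL : 0 ≤ L) (hB : 0 ≤ B)
    (δ : ℝ → X) (hδ : ContinuousOn δ (Icc s r)) (c : ℝ → X) (h : ℝ → ℝ → X)
    (heq : ∀ t ∈ Icc s r, δ t = c t + ∫ τ in s..t, h t τ)
    (hc : ∀ t ∈ Icc s r, ‖c t‖ ≤ A)
    (hh : ∀ t ∈ Icc s r, ∀ᵐ τ, τ ∈ Ioc s t → ‖h t τ‖ ≤ L * ‖δ τ‖ + B) :
    ∀ t ∈ Icc s r, ‖δ t‖ ≤ (A + B * (r - s)) * Real.exp (L * (t - s)) := by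
  let a : ℝ → ℝ := fun t => ‖δ (projIcc s r hsr t)‖
  have ha : Continuous a := by
    have : Continuous (fun t : Icc s r => δ t) := continuousOn_iff_continuous_domRestrict.1 hδ
    exact (this.comp continuous_projIcc).norm
  have ha' : ∀ t ∈ Icc s r, a t = ‖δ t‖ := by
    intro t ht
    simp [a, projIcc_of_mem hsr ht]
  let W : ℝ → ℝ := fun t => (A + B * (r - s)) + L * ∫ τ in s..t, a τ
  have hBr : 0 ≤ B * (r - s) := mul_nonneg hB (by linarith)
  have hWd : ∀ t, HasDerivAt W (L * a t) t := by
    intro t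
    exact ((ha.integral_hasStrictDerivAt s t).hasDerivAt.const_mul L).const_add _
  have hle : ∀ t ∈ Icc s r, a t ≤ W t := by
    intro t ht
    rw [ha' t ht, heq t ht]
    have h2 : ‖∫ τ in s..t, h t τ‖ ≤ ∫ τ in s..t, (L * a τ + B) := by
      refine intervalIntegral.norm_integral_le_of_norm_le ht.1 ?_ ?_
      · filter_upwards [hh t ht] with τ hτ hm
        rw [ha' τ ⟨hm.1.le, hm.2.trans ht.2⟩]
        exact hτ hm
      · exact ((continuous_const.mul ha).add continuous_const).intervalIntegrable _ _
    have h3 : ∫ τ in s..t, (L * a τ + B) = L * (∫ τ in s..t, a τ) + B * (t - s) := by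
      rw [intervalIntegral.integral_add, intervalIntegral.integral_const_mul]
      · simp [mul_comm]
      · exact (continuous_const.mul ha).intervalIntegrable _ _
      · exact continuous_const.intervalIntegrable _ _
    have h4 : B * (t - s) ≤ B * (r - s) := mul_le_mul_of_nonneg_left (by linarith [ht.2]) hB
    calc _ ≤ ‖c t‖ + ‖∫ τ in s..t, h t τ‖ := norm_add_le _ _
      _ ≤ A + (L * (∫ τ in s..t, a τ) + B * (t - s)) := by
          rw [← h3]; exact add_le_add (hc t ht) h2
      _ ≤ W t := by simp only [W]; linarith
  have hgr := norm_le_gronwallBound_of_norm_deriv_right_le (f := W) (f' := fun t => L * a t)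
    (δ := A + B * (r - s)) (K := L) (ε := 0) (a := s) (b := r)
    (fun t _ => (hWd t).continuousAt.continuousWithinAt)
    (fun t _ => (hWd t).hasDerivWithinAt)
    (by simp only [W, intervalIntegral.integral_same, mul_zero, add_zero]
        rw [Real.norm_of_nonneg (by linarith)])
    (by
      intro t ht
      have h1 := hle t ⟨ht.1, ht.2.le⟩
      have h0 : 0 ≤ a t := norm_nonneg _
      rw [Real.norm_of_nonneg (mul_nonneg hL h0), Real.norm_of_nonneg (h0.trans h1), add_zero]
      exact mul_le_mul_of_nonneg_left h1 hL)
  intro t ht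
  have := hgr t ht
  rw [gronwallBound_ε0] at this
  rw [← ha' t ht]
  exact (hle t ht).trans ((le_abs_self _).trans this)

/-- Approximately additive maps (with quadratic error) are differentiable. -/
theorem aux_diff {X : Type*} [NormedAddCommGroup X] [NormedSpace ℝ X] [CompleteSpace X]
    {Y : Type*} [NormedAddCommGroup Y] [NormedSpace ℝ Y] [CompleteSpace Y]
    (Ψ : X → Y) (x : X) {C L : ℝ} (_hC : 0 ≤ C) (_hL : 0 ≤ L)
    (hlip : ∀ v, ‖Ψ (x + v) - Ψ x‖ ≤ L * ‖v‖)
    (hadd : ∀ v w, ‖Ψ (x + (v + w)) - Ψ (x + v) - Ψ (x + w) + Ψ x‖ ≤ C * (‖v‖ + ‖w‖) ^ 2) :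
    DifferentiableAt ℝ Ψ x := by
  let d : X → Y := fun v => Ψ (x + v) - Ψ x
  have hdl : ∀ v, ‖d v‖ ≤ L * ‖v‖ := hlip
  have hda : ∀ v w, ‖d (v + w) - d v - d w‖ ≤ C * (‖v‖ + ‖w‖) ^ 2 := by
    intro v w
    have := hadd v w
    convert this using 2
    simp only [d]; abel
  let e : X → ℕ → Y := fun v n => (2 : ℝ) ^ n • d ((2⁻¹ : ℝ) ^ n • v)
  have hstep : ∀ v n, dist (e v n) (e v (n + 1)) ≤ (C * ‖v‖ ^ 2) / 2 ^ n := by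
    intro v n
    set w := (2⁻¹ : ℝ) ^ (n + 1) • v with hw
    have h1 : (2⁻¹ : ℝ) ^ n • v = w + w := by
      rw [← two_smul ℝ w, hw, smul_smul, pow_succ]; congr 1; ring
    have h2 : e v n - e v (n + 1) = (2 : ℝ) ^ n • (d (w + w) - d w - d w) := by
      simp only [e]
      rw [← hw, h1, pow_succ]
      generalize d (w + w) = P
      generalize d w = Q
      module
    have h3 : ‖w‖ = (2⁻¹ : ℝ) ^ (n + 1) * ‖v‖ := by
      rw [hw, norm_smul, Real.norm_of_nonneg (by positivity)]
    rw [dist_eq_norm, h2, norm_smul, Real.norm_of_nonneg (by positivity)]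
    calc _ ≤ (2 : ℝ) ^ n * (C * (‖w‖ + ‖w‖) ^ 2) := by gcongr; exact hda w w
      _ = (C * ‖v‖ ^ 2) / 2 ^ n := by
        rw [h3, inv_pow, pow_succ]; field_simp; ring
  have hcau : ∀ v, CauchySeq (e v) := fun v =>
    cauchySeq_of_le_geometric_two (C := 2 * (C * ‖v‖ ^ 2)) (fun n => by
      have := hstep v n
      convert this using 2; ring)
  choose D hD using fun v => cauchySeq_tendsto_of_complete (hcau v)
  have hDd : ∀ v, ‖d v - D v‖ ≤ 2 * (C * ‖v‖ ^ 2) := by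
    intro v
    have := dist_le_of_le_geometric_two_of_tendsto₀ (C := 2 * (C * ‖v‖ ^ 2)) (fun n => by
      have := hstep v n
      convert this using 2; ring) (hD v)
    simpa [e, dist_eq_norm] using this
  have hDL : ∀ v, ‖D v‖ ≤ L * ‖v‖ := by
    intro v
    refine le_of_tendsto (hD v).norm (Eventually.of_forall fun n => ?_)
    simp only [e]
    rw [norm_smul, Real.norm_of_nonneg (by positivity)]
    calc _ ≤ (2 : ℝ) ^ n * (L * ‖(2⁻¹ : ℝ) ^ n • v‖) := by gcongr; exact hdl _
      _ = L * ‖v‖ := by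
        rw [norm_smul, Real.norm_of_nonneg (by positivity), inv_pow]; field_simp
  have hDa : ∀ v w, D (v + w) = D v + D w := by
    intro v w
    have h1 : Tendsto (fun n => e (v + w) n - e v n - e w n) atTop (nhds (D (v + w) - D v - D w)) :=
      ((hD _).sub (hD v)).sub (hD w)
    have h2 : Tendsto (fun n => e (v + w) n - e v n - e w n) atTop (nhds 0) := by
      refine squeeze_zero_norm (a := fun n => (C * (‖v‖ + ‖w‖) ^ 2) * (2⁻¹ : ℝ) ^ n) ?_ ?_
      · intro n
        have : e (v + w) n - e v n - e w n = (2 : ℝ) ^ n • (d ((2⁻¹ : ℝ) ^ n • v + (2⁻¹ : ℝ) ^ n • w)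
          - d ((2⁻¹ : ℝ) ^ n • v) - d ((2⁻¹ : ℝ) ^ n • w)) := by
          simp only [e, smul_sub, smul_add]
        rw [this, norm_smul, Real.norm_of_nonneg (by positivity)]
        calc _ ≤ (2 : ℝ) ^ n * (C * (‖(2⁻¹ : ℝ) ^ n • v‖ + ‖(2⁻¹ : ℝ) ^ n • w‖) ^ 2) := by
              gcongr; exact hda _ _
          _ = _ := by
            rw [norm_smul, norm_smul, Real.norm_of_nonneg (by positivity), inv_pow]; field_simp
      · have := (tendsto_pow_atTop_nhds_zero_of_lt_one (r := (2⁻¹ : ℝ)) (by norm_num)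
          (by norm_num)).const_mul (C * (‖v‖ + ‖w‖) ^ 2)
        simpa using this
    have := tendsto_nhds_unique h1 h2
    rw [sub_sub, sub_eq_zero] at this
    exact this
  let D1 : X →+ Y := AddMonoidHom.mk' D hDa
  have hD1 : Continuous D1 := AddMonoidHomClass.continuous_of_bound D1 L hDL
  let D2 : X →L[ℝ] Y := D1.toRealLinearMap hD1
  have hfd : HasFDerivAt Ψ D2 x := by
    rw [hasFDerivAt_iff_isLittleO_nhds_zero]
    have : (fun v => Ψ (x + v) - Ψ x - D2 v) =O[nhds 0] (fun v => ‖v‖ ^ 2) := by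
      refine Asymptotics.IsBigO.of_bound (2 * C) (Eventually.of_forall fun v => ?_)
      have h := hDd v
      rw [Real.norm_of_nonneg (by positivity)]
      have h5 : Ψ (x + v) - Ψ x - D2 v = d v - D v := rfl
      rw [h5]; linarith
    refine this.trans_isLittleO ?_
    exact Asymptotics.isLittleO_norm_pow_id one_lt_two
  exact hfd.differentiableAt

structure AuxSG {X : Type*} [NormedAddCommGroup X] [NormedSpace ℝ X]
    (T C : ℝ) (S : ℝ → X →L[ℝ] X) : Prop where
  c0 : 0 ≤ C
  zero : S 0 = ContinuousLinearMap.id ℝ X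
  add : ∀ a b : ℝ, 0 ≤ a → 0 ≤ b → S (a + b) = (S a).comp (S b)
  cont : ∀ x : X, ContinuousOn (fun σ => S σ x) (Set.Ici (0 : ℝ))
  bd : ∀ σ ∈ Icc 0 T, ‖S σ‖ ≤ C

structure AuxF {X : Type*} [NormedAddCommGroup X] [NormedSpace ℝ X]
    (T K : ℝ) (F : ℝ → X → X) : Prop where
  k0 : 0 ≤ K
  meas : ∀ x, AEStronglyMeasurable (fun t => F t x) (volume.restrict (Icc (0:ℝ) T))
  lip : ∀ᵐ t ∂(volume.restrict (Icc (0:ℝ) T)), ∀ x y, ‖F t x - F t y‖ ≤ K * ‖x - y‖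
  bd : ∀ᵐ t ∂(volume.restrict (Icc (0:ℝ) T)), ‖F t 0‖ ≤ K
  quad : ∀ᵐ t ∂(volume.restrict (Icc (0:ℝ) T)), ∀ y, ∃ A : X →L[ℝ] X, ‖A‖ ≤ K ∧
    ∀ z, ‖F t z - F t y - A (z - y)‖ ≤ K * ‖z - y‖ ^ 2

section aux
variable {X : Type*} [NormedAddCommGroup X] [NormedSpace ℝ X]
  {T C K : ℝ} {S : ℝ → X →L[ℝ] X} {F F' : ℝ → X → X}

theorem AuxSG.le (hS : AuxSG T C S) {σ : ℝ} (h : σ ∈ Icc 0 T) (y : X) :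
    ‖S σ y‖ ≤ C * ‖y‖ :=
  (ContinuousLinearMap.le_opNorm _ _).trans
    (mul_le_mul_of_nonneg_right (hS.bd σ h) (norm_nonneg _))

theorem aux_intS (hS : AuxSG T C S) {s t : ℝ} (hs : 0 ≤ s) (hst : s ≤ t) (htT : t ≤ T)
    (k : ℝ → X) (hk : AEStronglyMeasurable k (volume.restrict (Icc s t))) (B : ℝ)
    (hB : ∀ᵐ τ ∂(volume.restrict (Icc s t)), ‖k τ‖ ≤ B) :
    IntervalIntegrable (fun τ => S (t - τ) (k τ)) volume s t := by
  rw [intervalIntegrable_iff_integrableOn_Icc_of_le hst]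
  refine Integrable.of_bound (C := C * B) ?_ ?_
  · refine aux_carath (fun τ y => S (t - τ) y) (fun y => ?_)
      (Eventually.of_forall fun τ => (S (t - τ)).continuous) k hk
    refine ContinuousOn.aestronglyMeasurable ?_ measurableSet_Icc
    exact (hS.cont y).comp (by fun_prop) (fun τ hτ => by simpa using hτ.2)
  · filter_upwards [hB, ae_restrict_mem measurableSet_Icc] with τ h1 h2
    exact (hS.le ⟨by linarith [h2.2], by linarith [h2.1]⟩ _).trans
      (mul_le_mul_of_nonneg_left h1 hS.c0)

theorem aux_ae_mono {s t T : ℝ} (hs : 0 ≤ s) (htT : t ≤ T) {p : ℝ → Prop}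
    (h : ∀ᵐ τ ∂(volume.restrict (Icc (0:ℝ) T)), p τ) :
    ∀ᵐ τ ∂(volume.restrict (Icc s t)), p τ :=
  ae_restrict_of_ae_restrict_of_subset (Icc_subset_Icc hs htT) h

theorem aux_ae_Ioc {s t T : ℝ} (hs : 0 ≤ s) (htT : t ≤ T) {p : ℝ → Prop}
    (h : ∀ᵐ τ ∂(volume.restrict (Icc (0:ℝ) T)), p τ) :
    ∀ᵐ τ, τ ∈ Ioc s t → p τ := by
  have := (ae_restrict_iff' measurableSet_Icc).1 h
  filter_upwards [this] with τ h1 h2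
  exact h1 ⟨hs.trans h2.1.le, h2.2.trans htT⟩

theorem aux_intF (hS : AuxSG T C S) (hF : AuxF T K F) {s t : ℝ} (hs : 0 ≤ s) (hst : s ≤ t)
    (htT : t ≤ T) (φ : ℝ → X) (hφ : ContinuousOn φ (Icc s t)) :
    IntervalIntegrable (fun τ => S (t - τ) (F τ (φ τ))) volume s t := by
  obtain ⟨R, hR⟩ := isCompact_Icc.exists_bound_of_continuousOn hφ
  have hsub : Icc s t ⊆ Icc 0 T := Icc_subset_Icc hs htT
  refine aux_intS hS hs hst htT _ ?_ (K * R + K) ?_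
  · refine aux_carath F (fun x => (hF.meas x).mono_measure (Measure.restrict_mono hsub le_rfl)) ?_ φ
      (hφ.aestronglyMeasurable measurableSet_Icc)
    filter_upwards [aux_ae_mono hs htT hF.lip] with τ h
    refine LipschitzWith.continuous (K := K.toNNReal) (LipschitzWith.of_dist_le_mul fun x y => ?_)
    rw [dist_eq_norm, dist_eq_norm, Real.coe_toNNReal _ hF.k0]
    exact h x y
  · filter_upwards [aux_ae_mono hs htT hF.lip, aux_ae_mono hs htT hF.bd,
      ae_restrict_mem measurableSet_Icc] with τ h1 h2 h3
    have h4 := h1 (φ τ) 0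
    rw [sub_zero] at h4
    have h5 : K * ‖φ τ‖ ≤ K * R := mul_le_mul_of_nonneg_left (hR τ h3) hF.k0
    calc ‖F τ (φ τ)‖ = ‖(F τ (φ τ) - F τ 0) + F τ 0‖ := by rw [sub_add_cancel]
      _ ≤ _ := norm_add_le _ _
      _ ≤ _ := by linarith

theorem aux_sub (hS : AuxSG T C S) (hF : AuxF T K F) (hF' : AuxF T K F') {s : ℝ} (hs : 0 ≤ s)
    {x y : X} {φ ψ : ℝ → X} (hφ : IsMildSol T S F s x φ) (hψ : IsMildSol T S F' s y ψ) :
    ∀ t ∈ Icc s T, φ t - ψ t =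
      S (t - s) (x - y) + ∫ τ in s..t, S (t - τ) (F τ (φ τ) - F' τ (ψ τ)) := by
  intro t ht
  have i1 := aux_intF hS hF hs ht.1 ht.2 φ (hφ.1.mono (Icc_subset_Icc le_rfl ht.2))
  have i2 := aux_intF hS hF' hs ht.1 ht.2 ψ (hψ.1.mono (Icc_subset_Icc le_rfl ht.2))
  rw [hφ.2 t ht, hψ.2 t ht]
  simp only [map_sub]
  rw [intervalIntegral.integral_sub i1 i2]
  abel

theorem aux_four (hS : AuxSG T C S) (hF : AuxF T K F) {s : ℝ} (hs : 0 ≤ s)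
    {x1 x2 x3 x4 : X} {φ1 φ2 φ3 φ4 : ℝ → X} (h1 : IsMildSol T S F s x1 φ1)
    (h2 : IsMildSol T S F s x2 φ2) (h3 : IsMildSol T S F s x3 φ3) (h4 : IsMildSol T S F s x4 φ4) :
    ∀ t ∈ Icc s T, φ1 t - φ2 t - φ3 t + φ4 t =
      S (t - s) (x1 - x2 - x3 + x4) + ∫ τ in s..t, S (t - τ)
        (F τ (φ1 τ) - F τ (φ2 τ) - F τ (φ3 τ) + F τ (φ4 τ)) := by
  intro t ht
  have i1 := aux_intF hS hF hs ht.1 ht.2 φ1 (h1.1.mono (Icc_subset_Icc le_rfl ht.2))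
  have i2 := aux_intF hS hF hs ht.1 ht.2 φ2 (h2.1.mono (Icc_subset_Icc le_rfl ht.2))
  have i3 := aux_intF hS hF hs ht.1 ht.2 φ3 (h3.1.mono (Icc_subset_Icc le_rfl ht.2))
  have i4 := aux_intF hS hF hs ht.1 ht.2 φ4 (h4.1.mono (Icc_subset_Icc le_rfl ht.2))
  rw [h1.2 t ht, h2.2 t ht, h3.2 t ht, h4.2 t ht]
  simp only [map_sub, map_add]
  rw [intervalIntegral.integral_add ((i1.sub i2).sub i3) i4,
    intervalIntegral.integral_sub (i1.sub i2) i3, intervalIntegral.integral_sub i1 i2]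
  abel

theorem aux_lip (hS : AuxSG T C S) (hF : AuxF T K F) {s : ℝ} (hs : 0 ≤ s)
    {x y : X} {φ ψ : ℝ → X} (hφ : IsMildSol T S F s x φ) (hψ : IsMildSol T S F s y ψ) :
    ∀ t ∈ Icc s T, ‖φ t - ψ t‖ ≤ (C * Real.exp (C * K * T)) * ‖x - y‖ := by
  intro t ht
  have hsT : s ≤ T := ht.1.trans ht.2
  have hCK : 0 ≤ C * K := mul_nonneg hS.c0 hF.k0
  have hCn : 0 ≤ C * ‖x - y‖ := mul_nonneg hS.c0 (norm_nonneg _)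
  have := aux_gronwall (s := s) (r := T) (A := C * ‖x - y‖) (L := C * K) (B := 0) hsT
    hCn hCK le_rfl (fun t => φ t - ψ t) (hφ.1.sub hψ.1) _ _ (aux_sub hS hF hF hs hφ hψ)
    (fun t ht => hS.le ⟨by linarith [ht.1], by linarith [ht.2]⟩ _) (by
      intro t ht
      filter_upwards [aux_ae_Ioc hs ht.2 hF.lip] with τ h1 h2
      refine (hS.le ⟨by linarith [h2.2], by linarith [h2.1, ht.2]⟩ _).trans ?_
      rw [add_zero, mul_assoc]
      exact mul_le_mul_of_nonneg_left (h1 h2 _ _) hS.c0) t ht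
  refine this.trans ?_
  rw [zero_mul, add_zero]
  have : Real.exp (C * K * (t - s)) ≤ Real.exp (C * K * T) :=
    Real.exp_le_exp.2 (mul_le_mul_of_nonneg_left (by linarith [ht.2]) hCK)
  calc _ ≤ C * ‖x - y‖ * Real.exp (C * K * T) := mul_le_mul_of_nonneg_left this hCn
    _ = _ := by ring

theorem aux_restart [CompleteSpace X] (hS : AuxSG T C S) (hF : AuxF T K F) {s r : ℝ} (hs : 0 ≤ s) (hsr : s ≤ r)
    (hrT : r ≤ T) {x : X} {φ : ℝ → X} (hφ : IsMildSol T S F s x φ) :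
    IsMildSol T S F r (φ r) φ := by
  refine ⟨hφ.1.mono (Icc_subset_Icc hsr le_rfl), fun t ht => ?_⟩
  have hst : s ≤ t := hsr.trans ht.1
  have i1 := aux_intF hS hF hs hsr hrT φ (hφ.1.mono (Icc_subset_Icc le_rfl hrT))
  have i2 := aux_intF hS hF hs hst ht.2 φ (hφ.1.mono (Icc_subset_Icc le_rfl ht.2))
  have e1 : S (t - r) (φ r) = S (t - s) x + ∫ τ in s..r, S (t - τ) (F τ (φ τ)) := by
    rw [hφ.2 r ⟨hsr, hrT⟩, map_add, ← ContinuousLinearMap.intervalIntegral_comp_comm _ i1]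
    congr 1
    · have := hS.add (t - r) (r - s) (by linarith [ht.1]) (by linarith)
      rw [show t - s = t - r + (r - s) by ring, this]; rfl
    · refine intervalIntegral.integral_congr fun τ hτ => ?_
      rw [uIcc_of_le hsr] at hτ
      have := hS.add (t - r) (r - τ) (by linarith [ht.1]) (by linarith [hτ.2])
      rw [show t - τ = t - r + (r - τ) by ring, this]; rfl
  rw [e1, hφ.2 t ⟨hst, ht.2⟩, add_assoc, intervalIntegral.integral_add_adjacent_intervals]
  · exact i2.mono_set (by rw [uIcc_of_le hsr, uIcc_of_le hst]; exact Icc_subset_Icc le_rfl ht.1)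
  · exact i2.mono_set (by rw [uIcc_of_le ht.1, uIcc_of_le hst]; exact Icc_subset_Icc hsr le_rfl)

theorem aux_quad (hS : AuxSG T C S) (hF : AuxF T K F) {s : ℝ} (hs : 0 ≤ s) (hsT : s ≤ T)
    (P : X → ℝ → X) (hP : ∀ x, IsMildSol T S F s x (P x)) :
    ∃ Q, 0 ≤ Q ∧ ∀ x v w, ‖P (x + (v + w)) T - P (x + v) T - P (x + w) T + P x T‖
      ≤ Q * (‖v‖ + ‖w‖) ^ 2 := by
  set E := C * Real.exp (C * K * T) with hE
  have hE0 : 0 ≤ E := mul_nonneg hS.c0 (Real.exp_pos _).le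
  have hCK : 0 ≤ C * K := mul_nonneg hS.c0 hF.k0
  have hT : 0 ≤ T := hs.trans hsT
  refine ⟨C * (3 * (K * E ^ 2)) * T * Real.exp (C * K * T), ?_, fun x v w => ?_⟩
  · have := hS.c0; have := hF.k0; positivity
  set N := ‖v‖ + ‖w‖ with hN
  have hN0 : 0 ≤ N := by positivity
  have hB0 : 0 ≤ C * (3 * (K * E ^ 2)) * N ^ 2 := by
    have := hS.c0; have := hF.k0; positivity
  have hsm : ∀ z, ‖z‖ ≤ N → ∀ τ ∈ Icc s T, ‖P (x + z) τ - P x τ‖ ≤ E * N := by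
    intro z hz τ hτ
    refine (aux_lip hS hF hs (hP (x + z)) (hP x) τ hτ).trans ?_
    rw [add_sub_cancel_left]
    exact mul_le_mul_of_nonneg_left hz hE0
  have := aux_gronwall (s := s) (r := T) (A := 0) (L := C * K) (B := C * (3 * (K * E ^ 2)) * N ^ 2) hsT
    le_rfl hCK hB0 (fun t => P (x + (v + w)) t - P (x + v) t - P (x + w) t + P x t)
    ((((hP _).1.sub (hP _).1).sub (hP _).1).add (hP _).1) _ _
    (aux_four hS hF hs (hP (x + (v + w))) (hP (x + v)) (hP (x + w)) (hP x))
    (fun t ht => by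
      rw [show x + (v + w) - (x + v) - (x + w) + x = 0 by abel, map_zero, norm_zero]) (by
      intro t ht
      filter_upwards [aux_ae_Ioc hs ht.2 hF.quad] with τ h1 h2
      obtain ⟨A, hA, hq⟩ := h1 h2 (P x τ)
      have hτ : τ ∈ Icc s T := ⟨h2.1.le, h2.2.trans ht.2⟩
      refine (hS.le ⟨by linarith [h2.2], by linarith [h2.1, ht.2]⟩ _).trans ?_
      have hq' : ∀ z, ‖z‖ ≤ N → ‖F τ (P (x + z) τ) - F τ (P x τ) - A (P (x + z) τ - P x τ)‖
          ≤ K * E ^ 2 * N ^ 2 := by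
        intro z hz
        refine (hq _).trans ?_
        have := hsm z hz τ hτ
        have h3 : ‖P (x + z) τ - P x τ‖ ^ 2 ≤ (E * N) ^ 2 := pow_le_pow_left₀ (norm_nonneg _) this 2
        calc _ ≤ K * (E * N) ^ 2 := mul_le_mul_of_nonneg_left h3 hF.k0
          _ = _ := by ring
      have q1 := hq' (v + w) (norm_add_le _ _)
      have q2 := hq' v (by linarith [norm_nonneg w])
      have q3 := hq' w (by linarith [norm_nonneg v])
      have hAe : ‖A (P (x + (v + w)) τ - P (x + v) τ - P (x + w) τ + P x τ)‖ ≤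
          K * ‖P (x + (v + w)) τ - P (x + v) τ - P (x + w) τ + P x τ‖ :=
        (A.le_opNorm _).trans (mul_le_mul_of_nonneg_right hA (norm_nonneg _))
      have hkey : ‖F τ (P (x + (v + w)) τ) - F τ (P (x + v) τ) - F τ (P (x + w) τ) + F τ (P x τ)‖
          ≤ K * ‖P (x + (v + w)) τ - P (x + v) τ - P (x + w) τ + P x τ‖
            + 3 * (K * E ^ 2 * N ^ 2) := by
        have : F τ (P (x + (v + w)) τ) - F τ (P (x + v) τ) - F τ (P (x + w) τ) + F τ (P x τ)
          = (A (P (x + (v + w)) τ - P (x + v) τ - P (x + w) τ + P x τ)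
          + (F τ (P (x + (v + w)) τ) - F τ (P x τ) - A (P (x + (v + w)) τ - P x τ)))
          - (F τ (P (x + v) τ) - F τ (P x τ) - A (P (x + v) τ - P x τ))
          - (F τ (P (x + w) τ) - F τ (P x τ) - A (P (x + w) τ - P x τ)) := by
          simp only [map_sub, map_add]; abel
        rw [this]
        refine (norm_sub_le _ _).trans ?_
        have g1 := norm_sub_le (A (P (x + (v + w)) τ - P (x + v) τ - P (x + w) τ + P x τ)
          + (F τ (P (x + (v + w)) τ) - F τ (P x τ) - A (P (x + (v + w)) τ - P x τ)))
          (F τ (P (x + v) τ) - F τ (P x τ) - A (P (x + v) τ - P x τ))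
        have g2 := norm_add_le (A (P (x + (v + w)) τ - P (x + v) τ - P (x + w) τ + P x τ))
          (F τ (P (x + (v + w)) τ) - F τ (P x τ) - A (P (x + (v + w)) τ - P x τ))
        linarith
      calc _ ≤ C * (K * ‖P (x + (v + w)) τ - P (x + v) τ - P (x + w) τ + P x τ‖
            + 3 * (K * E ^ 2 * N ^ 2)) := mul_le_mul_of_nonneg_left hkey hS.c0
        _ = _ := by ring) T ⟨hsT, le_rfl⟩
  refine this.trans ?_
  rw [zero_add]
  have he : Real.exp (C * K * (T - s)) ≤ Real.exp (C * K * T) :=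
    Real.exp_le_exp.2 (mul_le_mul_of_nonneg_left (by linarith) hCK)
  calc _ ≤ (C * (3 * (K * E ^ 2)) * N ^ 2 * T) * Real.exp (C * K * T) := by
        refine mul_le_mul (mul_le_mul_of_nonneg_left (by linarith) hB0) he (Real.exp_pos _).le
          (mul_nonneg hB0 hT)
    _ = _ := by ring

theorem aux_differentiable [CompleteSpace X] (hS : AuxSG T C S) (hF : AuxF T K F) {s : ℝ}
    (hs : 0 ≤ s) (hsT : s ≤ T)
    (P : X → ℝ → X) (hP : ∀ x, IsMildSol T S F s x (P x)) (x : X) :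
    DifferentiableAt ℝ (fun y => P y T) x := by
  obtain ⟨Q, hQ, h⟩ := aux_quad hS hF hs hsT P hP
  refine aux_diff _ x hQ (L := C * Real.exp (C * K * T))
    (mul_nonneg hS.c0 (Real.exp_pos _).le) (fun v => ?_) (h x)
  have := aux_lip hS hF hs (hP (x + v)) (hP x) T ⟨hsT, le_rfl⟩
  rwa [add_sub_cancel_left] at this

end aux

section aux2
variable {X : Type*} [NormedAddCommGroup X] [NormedSpace ℝ X]
  {T C K : ℝ} {S : ℝ → X →L[ℝ] X} {F F' : ℝ → X → X}

theorem aux_init (hS : AuxSG T C S) {s : ℝ} (hsT : s ≤ T) {x : X} {φ : ℝ → X}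
    (hφ : IsMildSol T S F s x φ) : φ s = x := by
  have := hφ.2 s ⟨le_rfl, hsT⟩
  simpa [hS.zero] using this

theorem aux_dev (hS : AuxSG T C S) (hF : AuxF T K F) (hF' : AuxF T K F') {s B : ℝ} (hs : 0 ≤ s)
    (hB : 0 ≤ B) {x : X} {φ ψ k : ℝ → X}
    (hφ : IsMildSol T S F s x φ) (hψ : IsMildSol T S F' s x ψ)
    (hk : ∀ᵐ τ ∂(volume.restrict (Icc (0:ℝ) T)), F τ (φ τ) - F' τ (φ τ) = k τ)
    (hkB : ∀ᵐ τ ∂(volume.restrict (Icc (0:ℝ) T)), ‖k τ‖ ≤ B) :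
    ∀ t ∈ Icc s T, ‖φ t - ψ t‖ ≤ (C * B * Real.exp (C * K * T)) * (t - s) := by
  intro t ht
  have hCK : 0 ≤ C * K := mul_nonneg hS.c0 hF.k0
  have hCB : 0 ≤ C * B := mul_nonneg hS.c0 hB
  have := aux_gronwall (s := s) (r := t) (A := 0) (L := C * K) (B := C * B) ht.1
    le_rfl hCK hCB (fun t => φ t - ψ t)
    ((hφ.1.sub hψ.1).mono (Icc_subset_Icc le_rfl ht.2)) _ _
    (fun r hr => aux_sub hS hF hF' hs hφ hψ r ⟨hr.1, hr.2.trans ht.2⟩)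
    (fun t ht => by simp) (by
      intro r hr
      filter_upwards [aux_ae_Ioc hs (hr.2.trans ht.2) hF'.lip, aux_ae_Ioc hs (hr.2.trans ht.2) hk,
        aux_ae_Ioc hs (hr.2.trans ht.2) hkB] with τ h1 h3 h4 h2
      refine (hS.le ⟨by linarith [h2.2], by linarith [h2.1, hr.2, ht.2]⟩ _).trans ?_
      have h5 : F τ (φ τ) - F' τ (ψ τ) = (F' τ (φ τ) - F' τ (ψ τ)) + k τ := by
        rw [← h3 h2]; abel
      have h6 : ‖F τ (φ τ) - F' τ (ψ τ)‖ ≤ K * ‖φ τ - ψ τ‖ + B := by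
        rw [h5]
        exact (norm_add_le _ _).trans (add_le_add (h1 h2 _ _) (h4 h2))
      calc _ ≤ C * (K * ‖φ τ - ψ τ‖ + B) := mul_le_mul_of_nonneg_left h6 hS.c0
        _ = _ := by ring) t ⟨ht.1, le_rfl⟩
  refine this.trans ?_
  have he : Real.exp (C * K * (t - s)) ≤ Real.exp (C * K * T) :=
    Real.exp_le_exp.2 (mul_le_mul_of_nonneg_left (by linarith [ht.2]) hCK)
  rw [zero_add]
  calc _ ≤ (C * B * (t - s)) * Real.exp (C * K * T) :=
        mul_le_mul_of_nonneg_left he (mul_nonneg hCB (by linarith [ht.1]))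
    _ = _ := by ring

theorem aux_left [CompleteSpace X] (hS : AuxSG T C S) (hF : AuxF T K F) (hF' : AuxF T K F')
    {B t : ℝ} (hB : 0 ≤ B) (ht0 : 0 < t) (htT : t ≤ T) {x₀ : X} {x k : ℝ → X} {P : ℝ → ℝ → X}
    (hx : IsMildSol T S F 0 x₀ x)
    (hP : ∀ s ∈ Icc 0 T, IsMildSol T S F' s (x s) (P s))
    (hk : ∀ᵐ τ ∂(volume.restrict (Icc (0:ℝ) T)), F τ (x τ) - F' τ (x τ) = k τ)
    (hkB : ∀ᵐ τ ∂(volume.restrict (Icc (0:ℝ) T)), ‖k τ‖ ≤ B)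
    (hki : IntegrableOn k (Icc 0 T))
    (hleb : Tendsto (fun s => (t - s)⁻¹ * ∫ τ in s..t, ‖k τ - k t‖) (nhdsWithin t (Iio t)) (nhds 0)) :
    HasDerivWithinAt (fun s => P s t) (k t) (Iic t) t := by
  rw [hasDerivWithinAt_iff_tendsto_slope, Iic_sdiff_right, Metric.tendsto_nhds]
  intro ε hε
  set E := C * B * Real.exp (C * K * T) with hE
  have hE0 : 0 ≤ E := mul_nonneg (mul_nonneg hS.c0 hB) (Real.exp_pos _).le
  have hPt : P t t = x t := aux_init hS htT (hP t ⟨ht0.le, htT⟩)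
  have ev1 : ∀ᶠ s in nhdsWithin t (Iio t), C * ((t - s)⁻¹ * ∫ τ in s..t, ‖k τ - k t‖) < ε / 4 := by
    have := hleb.const_mul C
    rw [mul_zero] at this
    exact this.eventually_lt_const (by linarith)
  have ev2 : ∀ᶠ s in nhdsWithin t (Iio t), C * (K * (E * (t - s))) < ε / 4 := by
    have : Tendsto (fun s => C * (K * (E * (t - s)))) (nhds t) (nhds (C * (K * (E * (t - t))))) :=
      Continuous.tendsto (by fun_prop) t
    simp only [sub_self, mul_zero] at this
    exact (this.mono_left nhdsWithin_le_nhds).eventually_lt_const (by linarith)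
  have ev3 : ∃ η > 0, ∀ σ ∈ Ico 0 η, ‖S σ (k t) - k t‖ ≤ ε / 4 := by
    have h1 := (hS.cont (k t)) 0 self_mem_Ici
    rw [Metric.continuousWithinAt_iff] at h1
    obtain ⟨η, hη, h⟩ := h1 (ε / 4) (by linarith)
    refine ⟨η, hη, fun σ hσ => ?_⟩
    have := h (mem_Ici.2 hσ.1) (by rw [Real.dist_eq, sub_zero, abs_of_nonneg hσ.1]; exact hσ.2)
    rw [dist_eq_norm, hS.zero] at this
    exact this.le
  obtain ⟨η, hη, hη'⟩ := ev3
  have ev4 : ∀ᶠ s in nhdsWithin t (Iio t), s ∈ Ioo (max 0 (t - η)) t :=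
    Ioo_mem_nhdsLT (max_lt ht0 (by linarith))
  filter_upwards [ev1, ev2, ev4] with s h1 h2 hs
  have hst : s < t := hs.2
  have hs0 : 0 ≤ s := (le_max_left _ _).trans hs.1.le
  have hsη : t - η < s := (le_max_right _ _).trans_lt hs.1
  have hsT : s ≤ T := hst.le.trans htT
  have hxs := aux_restart hS hF le_rfl hs0 hsT hx
  have hPs := hP s ⟨hs0, hsT⟩
  have hdev := aux_dev hS hF hF' hs0 hB hxs hPs hk hkB
  have hsub := aux_sub hS hF hF' hs0 hxs hPs t ⟨hst.le, htT⟩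
  have i1 : IntervalIntegrable (fun τ => S (t - τ) (F τ (x τ) - F' τ (P s τ))) volume s t := by
    simp only [map_sub]
    exact (aux_intF hS hF hs0 hst.le htT x (hxs.1.mono (Icc_subset_Icc le_rfl htT))).sub
      (aux_intF hS hF' hs0 hst.le htT (P s) (hPs.1.mono (Icc_subset_Icc le_rfl htT)))
  rw [sub_self, map_zero, zero_add] at hsub
  have e1 : (x t - P s t) - (t - s) • k t =
      ∫ τ in s..t, (S (t - τ) (F τ (x τ) - F' τ (P s τ)) - k t) := by
    rw [intervalIntegral.integral_sub i1 intervalIntegrable_const, ← hsub,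
      intervalIntegral.integral_const]
  have ik : IntervalIntegrable (fun τ => ‖k τ - k t‖) volume s t := by
    have : IntervalIntegrable k volume s t := by
      rw [intervalIntegrable_iff_integrableOn_Icc_of_le hst.le]
      exact hki.mono_set (Icc_subset_Icc hs0 htT)
    exact (this.sub intervalIntegrable_const).norm
  set R := C * (K * (E * (t - s))) + ε / 4 with hR
  have e2 : ‖(x t - P s t) - (t - s) • k t‖ ≤ C * (∫ τ in s..t, ‖k τ - k t‖) + (t - s) * R := by
    rw [e1]
    have : ∫ τ in s..t, (C * ‖k τ - k t‖ + R) = C * (∫ τ in s..t, ‖k τ - k t‖) + (t - s) * R := by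
      rw [intervalIntegral.integral_add (ik.const_mul C) intervalIntegrable_const,
        intervalIntegral.integral_const_mul, intervalIntegral.integral_const, smul_eq_mul]
    rw [← this]
    refine intervalIntegral.norm_integral_le_of_norm_le hst.le ?_
      ((ik.const_mul C).add intervalIntegrable_const)
    filter_upwards [aux_ae_Ioc hs0 htT hF'.lip, aux_ae_Ioc hs0 htT hk] with τ g1 g2 hτ
    have hσ : t - τ ∈ Icc 0 T := ⟨by linarith [hτ.2], by linarith [hτ.1]⟩
    have g3 : S (t - τ) (F τ (x τ) - F' τ (P s τ)) - k t =
        (S (t - τ) (k τ - k t) + S (t - τ) (F' τ (x τ) - F' τ (P s τ)))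
          + (S (t - τ) (k t) - k t) := by
      rw [← g2 hτ]; simp only [map_sub]; abel
    rw [g3]
    have g4 := hS.le hσ (k τ - k t)
    have g5 : ‖S (t - τ) (F' τ (x τ) - F' τ (P s τ))‖ ≤ C * (K * (E * (t - s))) := by
      refine (hS.le hσ _).trans (mul_le_mul_of_nonneg_left ?_ hS.c0)
      refine (g1 hτ _ _).trans (mul_le_mul_of_nonneg_left ?_ hF.k0)
      refine (hdev τ ⟨hτ.1.le, hτ.2.trans htT⟩).trans (mul_le_mul_of_nonneg_left ?_ hE0)
      linarith [hτ.2]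
    have g6 := hη' (t - τ) ⟨hσ.1, by linarith [hτ.1]⟩
    have g7 := norm_add_le (S (t - τ) (k τ - k t) + S (t - τ) (F' τ (x τ) - F' τ (P s τ)))
      (S (t - τ) (k t) - k t)
    have g8 := norm_add_le (S (t - τ) (k τ - k t)) (S (t - τ) (F' τ (x τ) - F' τ (P s τ)))
    linarith
  have hts : 0 < t - s := by linarith
  have e3 : slope (fun s => P s t) t s - k t = (t - s)⁻¹ • ((x t - P s t) - (t - s) • k t) := by
    rw [slope_def_module, hPt, smul_sub _ (x t - P s t), smul_smul, inv_mul_cancel₀ hts.ne', one_smul,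
      ← neg_sub t s, inv_neg, neg_smul, ← smul_neg, neg_sub]
  rw [dist_eq_norm, e3, norm_smul, Real.norm_of_nonneg (inv_nonneg.2 hts.le)]
  calc _ ≤ (t - s)⁻¹ * (C * (∫ τ in s..t, ‖k τ - k t‖) + (t - s) * R) :=
        mul_le_mul_of_nonneg_left e2 (inv_nonneg.2 hts.le)
    _ = C * ((t - s)⁻¹ * ∫ τ in s..t, ‖k τ - k t‖) + R := by field_simp
    _ < ε := by rw [hR]; linarith

end aux2

theorem aux_leb {X : Type*} [NormedAddCommGroup X] {T : ℝ} (k : ℝ → X)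
    (hk : IntegrableOn k (Icc 0 T)) :
    ∀ᵐ t, t ∈ Ioo 0 T → Tendsto (fun s => (t - s)⁻¹ * ∫ τ in s..t, ‖k τ - k t‖)
      (nhdsWithin t (Iio t)) (nhds 0) := by
  let k0 : ℝ → X := (Icc 0 T).indicator k
  have hk0 : Integrable k0 := (integrable_indicator_iff measurableSet_Icc).2 hk
  filter_upwards [IsUnifLocDoublingMeasure.ae_tendsto_average_norm_sub (μ := volume)
    hk0.locallyIntegrable 1] with t ht htT
  have hlim : Tendsto (fun s => t - s) (nhdsWithin t (Iio t)) (nhdsWithin 0 (Ioi 0)) := by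
    refine tendsto_nhdsWithin_iff.2 ⟨?_, ?_⟩
    · have : Tendsto (fun s => t - s) (nhds t) (nhds (t - t)) :=
        Continuous.tendsto (by fun_prop) t
      rw [sub_self] at this
      exact this.mono_left nhdsWithin_le_nhds
    · filter_upwards [self_mem_nhdsWithin] with s hs
      simpa using hs
  have h1 := ht (l := nhdsWithin t (Iio t)) (fun _ => t) (fun s => t - s) hlim (by
    filter_upwards [self_mem_nhdsWithin] with s hs
    have : s < t := hs
    simp [this.le])
  have h2 := h1.const_mul 2
  rw [mul_zero] at h2
  refine squeeze_zero' ?_ ?_ h2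
  · filter_upwards [self_mem_nhdsWithin] with s hs
    have hs : s < t := hs
    exact mul_nonneg (inv_nonneg.2 (by linarith))
      (intervalIntegral.integral_nonneg hs.le fun _ _ => norm_nonneg _)
  · filter_upwards [Ioo_mem_nhdsLT htT.1] with s hs
    have hts : 0 < t - s := by linarith [hs.2]
    rw [setAverage_eq, Real.closedBall_eq_Icc, Real.volume_real_Icc_of_le (by linarith), smul_eq_mul]
    have e1 : ∫ τ in s..t, ‖k τ - k t‖ = ∫ τ in Ioc s t, ‖k0 τ - k0 t‖ := by
      rw [intervalIntegral.integral_of_le hs.2.le]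
      refine setIntegral_congr_fun measurableSet_Ioc fun τ hτ => ?_
      simp only [k0]
      rw [indicator_of_mem, indicator_of_mem]
      · exact ⟨htT.1.le, htT.2.le⟩
      · exact ⟨hs.1.le.trans hτ.1.le, hτ.2.trans htT.2.le⟩
    have e2 : ∫ τ in Ioc s t, ‖k0 τ - k0 t‖ ≤
        ∫ τ in Icc (t - (t - s)) (t + (t - s)), ‖k0 τ - k0 t‖ := by
      refine setIntegral_mono_set ?_ (Eventually.of_forall fun _ => norm_nonneg _) ?_
      · exact ((hk0.integrableOn).sub (integrableOn_const (by simp))).norm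
      · refine LE.le.eventuallyLE fun τ hτ => ⟨by linarith [hτ.1], by linarith [hτ.2]⟩
    rw [e1]
    calc _ ≤ (t - s)⁻¹ * ∫ τ in Icc (t - (t - s)) (t + (t - s)), ‖k0 τ - k0 t‖ :=
          mul_le_mul_of_nonneg_left e2 (inv_nonneg.2 hts.le)
      _ = _ := by
        rw [show t + (t - s) - (t - (t - s)) = 2 * (t - s) by ring, mul_inv]; ring

theorem aux_clm {X Y : Type*} [NormedAddCommGroup X] [NormedSpace ℝ X] [NormedAddCommGroup Y]
    [NormedSpace ℝ Y] {μ : Measure ℝ} {A : ℝ → Y →L[ℝ] X} {v : ℝ → Y}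
    (hA : AEStronglyMeasurable A μ) (hv : AEStronglyMeasurable v μ) :
    AEStronglyMeasurable (fun t => A t (v t)) μ :=
  (isBoundedBilinearMap_apply (𝕜 := ℝ) (E := Y) (F := X)).continuous.comp_aestronglyMeasurable
    (hA.prodMk hv)

theorem aux_taylor {X Y : Type*} [NormedAddCommGroup X] [NormedSpace ℝ X] [NormedAddCommGroup Y]
    [NormedSpace ℝ Y] {g : X → Y} {M : ℝ} (hM : 0 ≤ M) (hg : ContDiff ℝ 1 g)
    (hl : ∀ x y : X, ‖fderiv ℝ g x - fderiv ℝ g y‖ ≤ M * ‖x - y‖) (y z : X) :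
    ‖g z - g y - fderiv ℝ g y (z - y)‖ ≤ M * ‖z - y‖ ^ 2 := by
  have h := Convex.norm_image_sub_le_of_norm_fderiv_le' (𝕜 := ℝ) (f := g) (φ := fderiv ℝ g y)
    (s := Metric.closedBall y ‖z - y‖) (x := y) (y := z) (C := M * ‖z - y‖)
    (fun x _ => (hg.differentiable one_ne_zero) x)
    (fun x hx => (hl x y).trans (mul_le_mul_of_nonneg_left (by
      rwa [Metric.mem_closedBall, dist_eq_norm] at hx) hM))
    (convex_closedBall _ _) (Metric.mem_closedBall_self (norm_nonneg _))
    (by rw [Metric.mem_closedBall, dist_eq_norm])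
  refine h.trans (le_of_eq (by ring))

theorem aux_mkF {X : Type*} [NormedAddCommGroup X] [NormedSpace ℝ X]
    {m : ℕ} {T : ℝ} (f : ℝ → X → X) (G : ℝ → X → EuclideanSpace ℝ (Fin m) →L[ℝ] X)
    {Mf MG : ℝ} (hMf : 0 ≤ Mf) (hMG : 0 ≤ MG)
    (hfmeas : ∀ x : X,
      AEStronglyMeasurable (fun t => f t x) (volume.restrict (Set.Icc (0:ℝ) T)))
    (hGmeas : ∀ x : X,
      AEStronglyMeasurable (fun t => G t x) (volume.restrict (Set.Icc (0:ℝ) T)))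
    (hA : ∀ᵐ t ∂(volume.restrict (Set.Icc (0:ℝ) T)),
        (∀ x y : X, ‖f t x - f t y‖ ≤ Mf * ‖x - y‖) ∧
        (∀ x y : X, ‖G t x - G t y‖ ≤ MG * ‖x - y‖) ∧
        ‖f t 0‖ ≤ Mf ∧ ‖G t 0‖ ≤ MG)
    {M : ℝ} (hM : 0 ≤ M)
    (hAplus : ∀ᵐ t ∂(volume.restrict (Set.Icc (0:ℝ) T)),
        ContDiff ℝ 1 (f t) ∧ ContDiff ℝ 1 (G t) ∧
        (∀ x : X, ‖fderiv ℝ (f t) x‖ ≤ M) ∧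
        (∀ x : X, ‖fderiv ℝ (G t) x‖ ≤ M) ∧
        (∀ x y : X, ‖fderiv ℝ (f t) x - fderiv ℝ (f t) y‖ ≤ M * ‖x - y‖) ∧
        (∀ x y : X, ‖fderiv ℝ (G t) x - fderiv ℝ (G t) y‖ ≤ M * ‖x - y‖))
    (u : ℝ → EuclideanSpace ℝ (Fin m))
    (hu_meas : AEStronglyMeasurable u (volume.restrict (Set.Icc (0:ℝ) T)))
    {R : ℝ} (hR : 0 ≤ R)
    (hu : ∀ᵐ t ∂(volume.restrict (Set.Icc (0:ℝ) T)), ‖u t‖ ≤ R) :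
    AuxF T ((Mf + MG * R) + (M + M * R)) (fun τ y => f τ y + G τ y (u τ)) := by
  have n1 : 0 ≤ MG * R := mul_nonneg hMG hR
  have n2 : 0 ≤ M * R := mul_nonneg hM hR
  refine ⟨by linarith, fun x => (hfmeas x).add (aux_clm (hGmeas x) hu_meas), ?_, ?_, ?_⟩
  · filter_upwards [hA, hu] with t h hut x y
    obtain ⟨h1, h2, -, -⟩ := h
    have e : f t x + G t x (u t) - (f t y + G t y (u t)) =
      (f t x - f t y) + (G t x - G t y) (u t) := by
      rw [_root_.sub_apply]; abel
    rw [e]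
    have g1 : ‖(G t x - G t y) (u t)‖ ≤ (MG * ‖x - y‖) * R :=
      ((G t x - G t y).le_opNorm _).trans (mul_le_mul (h2 x y) hut (norm_nonneg _)
        (mul_nonneg hMG (norm_nonneg _)))
    have g2 : 0 ≤ (M + M * R) * ‖x - y‖ := mul_nonneg (by linarith) (norm_nonneg _)
    have g3 := norm_add_le (f t x - f t y) ((G t x - G t y) (u t))
    have g4 := h1 x y
    nlinarith
  · filter_upwards [hA, hu] with t h hut
    obtain ⟨-, -, h1, h2⟩ := h
    have g1 : ‖(G t 0) (u t)‖ ≤ MG * R :=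
      ((G t 0).le_opNorm _).trans (mul_le_mul h2 hut (norm_nonneg _) hMG)
    have g3 := norm_add_le (f t 0) ((G t 0) (u t))
    linarith
  · filter_upwards [hAplus, hu] with t h hut y
    obtain ⟨c1, c2, b1, b2, l1, l2⟩ := h
    refine ⟨fderiv ℝ (f t) y + (fderiv ℝ (G t) y).flip (u t), ?_, fun z => ?_⟩
    · have g1 : ‖(fderiv ℝ (G t) y).flip (u t)‖ ≤ M * R := by
        refine (ContinuousLinearMap.le_opNorm _ _).trans ?_
        rw [ContinuousLinearMap.opNorm_flip]
        exact mul_le_mul (b2 y) hut (norm_nonneg _) hM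
      have g2 := norm_add_le (fderiv ℝ (f t) y) ((fderiv ℝ (G t) y).flip (u t))
      have g3 := b1 y
      linarith
    · have e : f t z + G t z (u t) - (f t y + G t y (u t)) -
          (fderiv ℝ (f t) y + (fderiv ℝ (G t) y).flip (u t)) (z - y) =
          (f t z - f t y - fderiv ℝ (f t) y (z - y)) +
          (G t z - G t y - fderiv ℝ (G t) y (z - y)) (u t) := by
        simp only [_root_.sub_apply, _root_.add_apply,
          ContinuousLinearMap.flip_apply]
        abel
      rw [e]
      have t1 := aux_taylor hM c1 l1 y z
      have t2 := aux_taylor hM c2 l2 y z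
      have g1 : ‖(G t z - G t y - fderiv ℝ (G t) y (z - y)) (u t)‖ ≤ (M * ‖z - y‖ ^ 2) * R :=
        (ContinuousLinearMap.le_opNorm _ _).trans (mul_le_mul t2 hut (norm_nonneg _)
          (mul_nonneg hM (by positivity)))
      have g2 := norm_add_le (f t z - f t y - fderiv ℝ (f t) y (z - y))
        ((G t z - G t y - fderiv ℝ (G t) y (z - y)) (u t))
      have g3 : 0 ≤ (Mf + MG * R) * ‖z - y‖ ^ 2 := mul_nonneg (by linarith) (by positivity)
      nlinarith

theorem aux_bdS {X : Type*} [NormedAddCommGroup X] [NormedSpace ℝ X] [CompleteSpace X]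
    {T : ℝ} (S : ℝ → X →L[ℝ] X)
    (hScont : ∀ x : X, ContinuousOn (fun σ => S σ x) (Set.Ici (0 : ℝ))) :
    ∃ C, 0 ≤ C ∧ ∀ σ ∈ Icc 0 T, ‖S σ‖ ≤ C := by
  obtain ⟨C, hC⟩ := banach_steinhaus (g := fun σ : Icc (0:ℝ) T => S σ) (by
    intro x
    obtain ⟨c, hc⟩ := isCompact_Icc.exists_bound_of_continuousOn
      ((hScont x).mono (fun σ (hσ : σ ∈ Icc 0 T) => hσ.1))
    exact ⟨c, fun σ => hc σ σ.2⟩)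
  exact ⟨max C 0, le_max_right _ _, fun σ hσ => (hC ⟨σ, hσ⟩).trans (le_max_left _ _)⟩

/-- `g(t) = p̄_t(x^u_t)` is absolutely continuous on `I` (it is an
indefinite integral of an integrable density `d`), and for a.e. `t ∈ I` its derivative
equals `(u(t) − ū(t))ᵀ G_t(x_t)' Dp̄_t(x_t) = Dp̄_t(x_t)[G_t(x_t)(u(t) − ū(t))]`. -/
theorem backward_cost_along_trajectory_derivative
    {X : Type*} [NormedAddCommGroup X] [NormedSpace ℝ X] [CompleteSpace X]
    {m : ℕ} {T : ℝ} (hT : 0 < T)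
    (S : ℝ → X →L[ℝ] X)
    (hS0 : S 0 = ContinuousLinearMap.id ℝ X)
    (hSadd : ∀ a b : ℝ, 0 ≤ a → 0 ≤ b → S (a + b) = (S a).comp (S b))
    (hScont : ∀ x : X, ContinuousOn (fun σ => S σ x) (Set.Ici (0 : ℝ)))
    (U : Set (EuclideanSpace ℝ (Fin m))) (hUcpt : IsCompact U) (hUcvx : Convex ℝ U)
    (f : ℝ → X → X) (G : ℝ → X → EuclideanSpace ℝ (Fin m) →L[ℝ] X)
    {Mf MG : ℝ} (hMf : 0 ≤ Mf) (hMG : 0 ≤ MG)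
    (hfmeas : ∀ x : X,
      AEStronglyMeasurable (fun t => f t x) (volume.restrict (Set.Icc (0:ℝ) T)))
    (hGmeas : ∀ x : X,
      AEStronglyMeasurable (fun t => G t x) (volume.restrict (Set.Icc (0:ℝ) T)))
    (hA : ∀ᵐ t ∂(volume.restrict (Set.Icc (0:ℝ) T)),
        (∀ x y : X, ‖f t x - f t y‖ ≤ Mf * ‖x - y‖) ∧
        (∀ x y : X, ‖G t x - G t y‖ ≤ MG * ‖x - y‖) ∧
        ‖f t 0‖ ≤ Mf ∧ ‖G t 0‖ ≤ MG)
    {M : ℝ} (hM : 0 ≤ M)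
    (hDfmeas : ∀ x : X,
      AEStronglyMeasurable (fun t => fderiv ℝ (f t) x) (volume.restrict (Set.Icc (0:ℝ) T)))
    (hDGmeas : ∀ x : X,
      AEStronglyMeasurable (fun t => fderiv ℝ (G t) x) (volume.restrict (Set.Icc (0:ℝ) T)))
    (hAplus : ∀ᵐ t ∂(volume.restrict (Set.Icc (0:ℝ) T)),
        ContDiff ℝ 1 (f t) ∧ ContDiff ℝ 1 (G t) ∧
        (∀ x : X, ‖fderiv ℝ (f t) x‖ ≤ M) ∧
        (∀ x : X, ‖fderiv ℝ (G t) x‖ ≤ M) ∧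
        (∀ x y : X, ‖fderiv ℝ (f t) x - fderiv ℝ (f t) y‖ ≤ M * ‖x - y‖) ∧
        (∀ x y : X, ‖fderiv ℝ (G t) x - fderiv ℝ (G t) y‖ ≤ M * ‖x - y‖))
    (ubar : ℝ → EuclideanSpace ℝ (Fin m))
    (hubar_meas : AEStronglyMeasurable ubar (volume.restrict (Set.Icc (0:ℝ) T)))
    (hubar_mem : ∀ᵐ t ∂(volume.restrict (Set.Icc (0:ℝ) T)), ubar t ∈ U)
    (Φ : ℝ → ℝ → X → X)
    (hΦ : ∀ s ∈ Set.Icc (0:ℝ) T, ∀ x : X,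
      IsMildSol T S (fun τ y => f τ y + G τ y (ubar τ)) s x (fun t => Φ s t x))
    (ℓ : X → ℝ) (hℓ : ContDiff ℝ 1 ℓ)
    (hℓLip : ∀ B : Set X, Bornology.IsBounded B →
      ∃ K : ℝ, ∀ x ∈ B, ∀ y ∈ B, |ℓ x - ℓ y| ≤ K * ‖x - y‖)
    (u : ℝ → EuclideanSpace ℝ (Fin m))
    (hu_meas : AEStronglyMeasurable u (volume.restrict (Set.Icc (0:ℝ) T)))
    (hu_mem : ∀ᵐ t ∂(volume.restrict (Set.Icc (0:ℝ) T)), u t ∈ U)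
    (x₀ : X) (xu : ℝ → X)
    (hxu : IsMildSol T S (fun τ y => f τ y + G τ y (u τ)) 0 x₀ xu)
 :
    ∃ d : ℝ → ℝ, IntegrableOn d (Set.Icc (0:ℝ) T) ∧
      (∀ t ∈ Set.Icc (0:ℝ) T,
        ℓ (Φ t T (xu t)) = ℓ (Φ 0 T (xu 0)) + ∫ τ in (0:ℝ)..t, d τ) ∧
      (∀ᵐ t ∂(volume.restrict (Set.Icc (0:ℝ) T)),
        d t = fderiv ℝ (fun y => ℓ (Φ t T y)) (xu t) (G t (xu t) (u t - ubar t))) ∧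
      (∀ᵐ t ∂(volume.restrict (Set.Icc (0:ℝ) T)),
        HasDerivAt (fun τ => ℓ (Φ τ T (xu τ)))
          (fderiv ℝ (fun y => ℓ (Φ t T y)) (xu t) (G t (xu t) (u t - ubar t))) t) := by
  obtain ⟨C, hC0, hC⟩ := aux_bdS (T := T) S hScont
  have hS : AuxSG T C S := ⟨hC0, hS0, hSadd, hScont, hC⟩
  obtain ⟨R, hR0, hR⟩ : ∃ R, 0 ≤ R ∧ ∀ v ∈ U, ‖v‖ ≤ R := by
    obtain ⟨R, hR⟩ := hUcpt.isBounded.exists_norm_le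
    exact ⟨max R 0, le_max_right _ _, fun v hv => (hR v hv).trans (le_max_left _ _)⟩
  have huR : ∀ᵐ t ∂(volume.restrict (Set.Icc (0:ℝ) T)), ‖u t‖ ≤ R :=
    hu_mem.mono fun t ht => hR _ ht
  have hubR : ∀ᵐ t ∂(volume.restrict (Set.Icc (0:ℝ) T)), ‖ubar t‖ ≤ R :=
    hubar_mem.mono fun t ht => hR _ ht
  have hF := aux_mkF f G hMf hMG hfmeas hGmeas hA hM hAplus u hu_meas hR0 huR
  have hF' := aux_mkF f G hMf hMG hfmeas hGmeas hA hM hAplus ubar hubar_meas hR0 hubR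
  set K := (Mf + MG * R) + (M + M * R) with hK
  -- the density
  let k : ℝ → X := fun t => G t (xu t) (u t - ubar t)
  have hkeq : ∀ᵐ τ ∂(volume.restrict (Icc (0:ℝ) T)),
      (f τ (xu τ) + G τ (xu τ) (u τ)) - (f τ (xu τ) + G τ (xu τ) (ubar τ)) = k τ :=
    Eventually.of_forall fun τ => by simp only [k, map_sub]; abel
  obtain ⟨Rx, hRx⟩ := isCompact_Icc.exists_bound_of_continuousOn hxu.1
  have hRx0 : 0 ≤ Rx := (norm_nonneg _).trans (hRx 0 ⟨le_rfl, hT.le⟩)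
  set B := (MG * Rx + MG) * (R + R) with hBdef
  have hB0 : 0 ≤ B := by positivity
  have hkB : ∀ᵐ τ ∂(volume.restrict (Icc (0:ℝ) T)), ‖k τ‖ ≤ B := by
    filter_upwards [hA, huR, hubR, ae_restrict_mem measurableSet_Icc] with τ h h1 h2 h3
    obtain ⟨-, hl, -, hg0⟩ := h
    refine (ContinuousLinearMap.le_opNorm _ _).trans ?_
    refine mul_le_mul ?_ ((norm_sub_le _ _).trans (add_le_add h1 h2)) (norm_nonneg _) (by positivity)
    have g1 := hl (xu τ) 0
    rw [sub_zero] at g1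
    have g2 : MG * ‖xu τ‖ ≤ MG * Rx := mul_le_mul_of_nonneg_left (hRx τ h3) hMG
    calc ‖G τ (xu τ)‖ = ‖(G τ (xu τ) - G τ 0) + G τ 0‖ := by rw [sub_add_cancel]
      _ ≤ _ := norm_add_le _ _
      _ ≤ _ := by linarith
  have hki : IntegrableOn k (Icc 0 T) := by
    refine Integrable.of_bound (C := B) ?_ hkB
    refine aux_clm ?_ (hu_meas.sub hubar_meas)
    refine aux_carath G hGmeas ?_ xu (hxu.1.aestronglyMeasurable measurableSet_Icc)
    filter_upwards [hAplus] with t h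
    exact h.2.1.continuous
  -- flow
  have hflow : ∀ s t, 0 ≤ s → s ≤ t → t ≤ T → ∀ x, Φ t T (Φ s t x) = Φ s T x := by
    intro s t hs hst htT x
    have h1 := aux_restart hS hF' hs hst htT (hΦ s ⟨hs, hst.trans htT⟩ x)
    have h2 := hΦ t ⟨hs.trans hst, htT⟩ (Φ s t x)
    have h3 := aux_lip hS hF' (hs.trans hst) h2 h1 T ⟨htT, le_rfl⟩
    rw [sub_self, norm_zero, mul_zero] at h3
    exact sub_eq_zero.1 (norm_le_zero_iff.1 h3)
  set E1 := C * Real.exp (C * K * T) with hE1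
  set E2 := C * B * Real.exp (C * K * T) with hE2
  have hE10 : 0 ≤ E1 := by positivity
  have hE20 : 0 ≤ E2 := by positivity
  let q : ℝ → X := fun t => Φ t T (xu t)
  have hqlip : ∀ s t, 0 ≤ s → s ≤ t → t ≤ T → ‖q t - q s‖ ≤ E1 * E2 * (t - s) := by
    intro s t hs hst htT
    have hsT := hst.trans htT
    have h1 := aux_dev hS hF hF' hs hB0 (aux_restart hS hF le_rfl hs hsT hxu)
      (hΦ s ⟨hs, hsT⟩ (xu s)) hkeq hkB t ⟨hst, htT⟩
    have h2 := aux_lip hS hF' (hs.trans hst) (hΦ t ⟨hs.trans hst, htT⟩ (xu t))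
      (hΦ t ⟨hs.trans hst, htT⟩ (Φ s t (xu s))) T ⟨htT, le_rfl⟩
    simp only [hflow s t hs hst htT] at h2
    calc _ ≤ E1 * ‖xu t - Φ s t (xu s)‖ := h2
      _ ≤ E1 * (E2 * (t - s)) := mul_le_mul_of_nonneg_left h1 hE10
      _ = _ := by ring
  have hqb : Bornology.IsBounded (q '' Icc 0 T) := by
    refine (Metric.isBounded_closedBall (x := q 0) (r := E1 * E2 * T)).subset ?_
    rintro _ ⟨t, ht, rfl⟩
    rw [Metric.mem_closedBall, dist_eq_norm]
    refine (hqlip 0 t le_rfl ht.1 ht.2).trans (mul_le_mul_of_nonneg_left ?_ (by positivity))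
    linarith [ht.2]
  obtain ⟨Kl, hKl⟩ := hℓLip _ hqb
  let g : ℝ → ℝ := fun t => ℓ (q t)
  set L := max Kl 0 * (E1 * E2) with hL
  have hL0 : 0 ≤ L := by positivity
  have hglip' : ∀ s t, 0 ≤ s → s ≤ t → t ≤ T → |g t - g s| ≤ L * (t - s) := by
    intro s t hs hst htT
    calc _ ≤ Kl * ‖q t - q s‖ := hKl _ ⟨t, ⟨hs.trans hst, htT⟩, rfl⟩ _ ⟨s, ⟨hs, hst.trans htT⟩, rfl⟩
      _ ≤ max Kl 0 * ‖q t - q s‖ := mul_le_mul_of_nonneg_right (le_max_left _ _) (norm_nonneg _)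
      _ ≤ max Kl 0 * (E1 * E2 * (t - s)) :=
        mul_le_mul_of_nonneg_left (hqlip s t hs hst htT) (le_max_right _ _)
      _ = _ := by ring
  have hglip : LipschitzOnWith L.toNNReal g (Icc 0 T) := by
    refine LipschitzOnWith.of_dist_le_mul fun s hs t ht => ?_
    rw [Real.coe_toNNReal _ hL0, Real.dist_eq, Real.dist_eq]
    rcases le_total s t with h | h
    · rw [abs_sub_comm, abs_sub_comm s t, abs_of_nonneg (sub_nonneg.2 h)]
      exact hglip' s t hs.1 h ht.2
    · rw [abs_of_nonneg (sub_nonneg.2 h)]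
      exact hglip' t s ht.1 h hs.2
  have hac : AbsolutelyContinuousOnInterval g 0 T :=
    LipschitzOnWith.absolutelyContinuousOnInterval (by rwa [uIcc_of_le hT.le])
  -- main derivative identity
  have hmain : ∀ᵐ t ∂(volume.restrict (Set.Icc (0:ℝ) T)), HasDerivAt g
      (fderiv ℝ (fun y => ℓ (Φ t T y)) (xu t) (G t (xu t) (u t - ubar t))) t := by
    rw [← restrict_Ioo_eq_restrict_Icc, ae_restrict_iff' measurableSet_Ioo]
    filter_upwards [aux_leb k hki, hac.ae_differentiableAt] with t h1 h2 ht
    have htI : t ∈ Icc 0 T := ⟨ht.1.le, ht.2.le⟩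
    have hd := h2 (by rwa [uIcc_of_le hT.le])
    have hleft := aux_left hS hF hF' hB0 ht.1 ht.2.le hxu
      (P := fun s t => Φ s t (xu s)) (fun s hs => hΦ s hs (xu s)) hkeq hkB hki (h1 ht)
    have hdp : DifferentiableAt ℝ (fun y => ℓ (Φ t T y)) (xu t) := by
      have := aux_differentiable hS hF' htI.1 htI.2 (fun x τ => Φ t τ x) (fun x => hΦ t htI x) (xu t)
      exact ((hℓ.differentiable one_ne_zero) _).comp (xu t) this
    have hinit : Φ t t (xu t) = xu t := aux_init hS htI.2 (hΦ t htI (xu t))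
    have hdp' : HasFDerivAt (fun y => ℓ (Φ t T y)) (fderiv ℝ (fun y => ℓ (Φ t T y)) (xu t))
        (Φ t t (xu t)) := by
      rw [hinit]; exact hdp.hasFDerivAt
    have hcomp := hdp'.comp_hasDerivWithinAt t hleft
    have hg : HasDerivWithinAt g
      (fderiv ℝ (fun y => ℓ (Φ t T y)) (xu t) (k t)) (Iic t) t := by
      refine hcomp.congr_of_eventuallyEq ?_ ?_
      · filter_upwards [Ioc_mem_nhdsLE ht.1] with s hs
        simp only [g, q, Function.comp]
        rw [hflow s t hs.1.le hs.2 htI.2]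
      · simp only [g, q, Function.comp]
        rw [hinit]
    have huniq := (uniqueDiffWithinAt_Iic t).eq_deriv _ hg hd.hasDerivAt.hasDerivWithinAt
    have := hd.hasDerivAt
    rw [← huniq] at this
    exact this
  refine ⟨deriv g, ?_, ?_, ?_, hmain⟩
  · have := hac.intervalIntegrable_deriv
    rwa [intervalIntegrable_iff_integrableOn_Icc_of_le hT.le] at this
  · intro t ht
    have := (hac.mono (c := 0) (d := t) (by
      rw [uIcc_of_le ht.1, uIcc_of_le hT.le]; exact Icc_subset_Icc le_rfl ht.2)).integral_deriv_eq_sub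
    rw [this]
    simp only [g, q]; ring
  · filter_upwards [hmain] with t ht
    exact ht.deriv
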